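/- Let u : ℝ³ → ℝ³ be smooth with u = ∇·Φ for smooth Φ, and let ψ be a cutoff with 0 ≤ ψ ≤ 1 supported in B(R) and |∇ψ| ≤ c(R−ρ)^{−1}, 1 ≤ ρ < R ≤ 2ρ. Then ∫_{B(R)} |u|³ψ³ dx ≤ C (∫_{B(R)} |Φ − Φ_{B(R)}|⁶ dx)^{1/4} (∫_{B(R)} |∇u|² dx)^{3/4} + C R^{3/2}(R−ρ)^{−3} (∫_{B(R)} |Φ − Φ_{B(R)}|⁶ dx)^{1/2}. -/

import Mathlib

open MeasureTheory

noncomputable abbrev E3 : Type := EuclideanSpace ℝ (Fin 3)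

/-- Partial derivative `∂_i f (x)`. -/
noncomputable def pd (f : E3 → ℝ) (i : Fin 3) (x : E3) : ℝ :=
  fderiv ℝ f x (EuclideanSpace.single i 1)

/-- Divergence of a matrix field: `(∇·Φ)_j = ∑_i ∂_i Φ_{ij}`. -/
noncomputable def matDiv (Φ : E3 → Fin 3 → Fin 3 → ℝ) (x : E3) (j : Fin 3) : ℝ :=
  ∑ i, pd (fun y => Φ y i j) i x

theorem hasDerivAt_abs_mul_self (t : ℝ) : HasDerivAt (fun s : ℝ => |s| * s) (2 * |t|) t := by
  rcases lt_trichotomy t 0 with h | rfl | h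
  · convert! (hasDerivAt_abs_neg h).mul (hasDerivAt_id t) using 1
    simp [abs_of_neg h]
    ring
  · rw [hasDerivAt_iff_tendsto_slope_zero]
    have h : Filter.Tendsto (fun s : ℝ => |s|) (nhdsWithin 0 {0}ᶜ) (nhds (2 * |0|)) := by
      simpa using (continuous_abs.tendsto (0 : ℝ)).mono_left nhdsWithin_le_nhds
    refine h.congr' ?_
    filter_upwards [self_mem_nhdsWithin] with s hs
    have hs : s ≠ 0 := hs
    simp
    field_simp
  · convert! (hasDerivAt_abs_pos h).mul (hasDerivAt_id t) using 1
    simp [abs_of_pos h]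
    ring

/-- Hölder's inequality for three nonnegative functions. -/
theorem integral_rpow_mul_rpow_mul_rpow_le {α : Type*} [MeasurableSpace α] {μ : Measure α}
    {f g h : α → ℝ} (hf : Integrable f μ) (hg : Integrable g μ) (hh : Integrable h μ)
    (hf0 : ∀ x, 0 ≤ f x) (hg0 : ∀ x, 0 ≤ g x) (hh0 : ∀ x, 0 ≤ h x)
    {a b c : ℝ} (ha : 0 ≤ a) (hb : 0 ≤ b) (hc : 0 ≤ c) (habc : a + b + c = 1) :
    ∫ x, f x ^ a * g x ^ b * h x ^ c ∂μ
      ≤ (∫ x, f x ∂μ) ^ a * (∫ x, g x ∂μ) ^ b * (∫ x, h x ∂μ) ^ c := by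
  have key := ENNReal.lintegral_prod_norm_pow_le (μ := μ) Finset.univ
    (f := ![fun x => ENNReal.ofReal (f x), fun x => ENNReal.ofReal (g x),
      fun x => ENNReal.ofReal (h x)]) (p := ![a, b, c])
    (by
      intro i _
      fin_cases i
      · exact hf.aemeasurable.ennreal_ofReal
      · exact hg.aemeasurable.ennreal_ofReal
      · exact hh.aemeasurable.ennreal_ofReal)
    (by simpa [Fin.sum_univ_three] using habc)
    (by intro i _; fin_cases i <;> simpa)
  simp only [Fin.prod_univ_three, Matrix.cons_val_zero, Matrix.cons_val_one,
    Matrix.cons_val] at key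
  rw [← ofReal_integral_eq_lintegral_ofReal hf (.of_forall hf0),
    ← ofReal_integral_eq_lintegral_ofReal hg (.of_forall hg0),
    ← ofReal_integral_eq_lintegral_ofReal hh (.of_forall hh0),
    ENNReal.ofReal_rpow_of_nonneg (integral_nonneg hf0) ha,
    ENNReal.ofReal_rpow_of_nonneg (integral_nonneg hg0) hb,
    ENNReal.ofReal_rpow_of_nonneg (integral_nonneg hh0) hc,
    ← ENNReal.ofReal_mul (Real.rpow_nonneg (integral_nonneg hf0) _),
    ← ENNReal.ofReal_mul (mul_nonneg (Real.rpow_nonneg (integral_nonneg hf0) _)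
      (Real.rpow_nonneg (integral_nonneg hg0) _))] at key
  have hmeas : AEStronglyMeasurable (fun x => f x ^ a * g x ^ b * h x ^ c) μ :=
    (((hf.aemeasurable.pow_const a).mul (hg.aemeasurable.pow_const b)).mul
      (hh.aemeasurable.pow_const c)).aestronglyMeasurable
  have hnn : ∀ x, 0 ≤ f x ^ a * g x ^ b * h x ^ c := fun x =>
    mul_nonneg (mul_nonneg (Real.rpow_nonneg (hf0 x) _) (Real.rpow_nonneg (hg0 x) _))
      (Real.rpow_nonneg (hh0 x) _)
  rw [integral_eq_lintegral_of_nonneg_ae (.of_forall hnn) hmeas]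
  refine ENNReal.toReal_le_of_le_ofReal ?_ (le_trans (le_of_eq ?_) key)
  · exact mul_nonneg (mul_nonneg (Real.rpow_nonneg (integral_nonneg hf0) _)
      (Real.rpow_nonneg (integral_nonneg hg0) _)) (Real.rpow_nonneg (integral_nonneg hh0) _)
  · refine lintegral_congr fun x => ?_
    rw [ENNReal.ofReal_rpow_of_nonneg (hf0 x) ha, ENNReal.ofReal_rpow_of_nonneg (hg0 x) hb,
      ENNReal.ofReal_rpow_of_nonneg (hh0 x) hc, ← ENNReal.ofReal_mul (Real.rpow_nonneg (hf0 x) _),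
      ← ENNReal.ofReal_mul (mul_nonneg (Real.rpow_nonneg (hf0 x) _) (Real.rpow_nonneg (hg0 x) _))]

theorem cube_le_of_cube_le_add {x p q : ℝ} (hx : 0 ≤ x) (hp : 0 ≤ p) (hq : 0 ≤ q)
    (h : x ^ 3 ≤ p * x + q * x ^ 2) : x ^ 3 ≤ (2 * p) ^ ((3 : ℝ) / 2) + (2 * q) ^ 3 := by
  have hP : 0 ≤ (2 * p) ^ ((3 : ℝ) / 2) := by positivity
  have hQ : 0 ≤ (2 * q) ^ 3 := by positivity
  rcases hx.eq_or_lt with rfl | hx'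
  · linarith
  have h2 : x ^ 2 ≤ p + q * x := by
    refine le_of_mul_le_mul_right ?_ hx'
    linarith
  rcases le_total p (q * x) with hc | hc
  · have : x ≤ 2 * q := by
      refine le_of_mul_le_mul_right ?_ hx'
      linarith
    have := pow_le_pow_left₀ hx this 3
    linarith
  · have h3 : x ^ 2 ≤ 2 * p := by linarith
    have h4 := Real.rpow_le_rpow (by positivity) h3 (by norm_num : (0 : ℝ) ≤ 3 / 2)
    rw [← Real.rpow_natCast, ← Real.rpow_mul hx] at h4
    norm_num at h4
    linarith

theorem Continuous.integrableOn_metric_ball {f : E3 → ℝ} (hf : Continuous f) (R : ℝ) :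
    IntegrableOn f (Metric.ball (0 : E3) R) :=
  (hf.locallyIntegrable.integrableOn_isCompact (isCompact_closedBall 0 R)).mono_set
    Metric.ball_subset_closedBall

/-- Testing a divergence `w = ∑ ∂_i f_i` against `|w| w ψ³` and integrating by parts. -/
theorem integral_abs_cube_mul_cutoff_eq {f : Fin 3 → E3 → ℝ} {w ψ : E3 → ℝ}
    (hf : ∀ i, ContDiff ℝ 1 (f i)) (hw : ContDiff ℝ 1 w) (hψ : ContDiff ℝ 1 ψ)
    (hsupp : HasCompactSupport ψ) (hdiv : ∀ x, w x = ∑ i, pd (f i) i x) :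
    ∫ x, |w x| ^ 3 * ψ x ^ 3 = ∑ i, -∫ x, (2 * |w x| * pd w i x * ψ x ^ 3
      + |w x| * w x * (3 * ψ x ^ 2 * pd ψ i x)) * f i x := by
  have hpd : ∀ {g : E3 → ℝ}, ContDiff ℝ 1 g → ∀ i, Continuous (pd g i) := fun hg i =>
    (hg.continuous_fderiv (by simp)).clm_apply continuous_const
  have hwc := hw.continuous
  have hψc := hψ.continuous
  have hcs : ∀ G : E3 → ℝ, Continuous G → (∀ x, ψ x = 0 → G x = 0) → Integrable G := by
    intro G hG h0
    exact hG.integrable_of_hasCompactSupport (hsupp.mono fun x hx hx' => hx (h0 x hx'))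
  have hder : ∀ x, HasFDerivAt (fun x => |w x| * w x * ψ x ^ 3)
      ((|w x| * w x) • ((3 * ψ x ^ 2) • fderiv ℝ ψ x)
        + ψ x ^ 3 • ((2 * |w x|) • fderiv ℝ w x)) x := by
    intro x
    have h1 := (hasDerivAt_abs_mul_self (w x)).comp_hasFDerivAt x
      (hw.differentiable (by simp) x).hasFDerivAt
    have h2 := ((hψ.differentiable (by simp) x).hasFDerivAt).pow 3
    convert! h1.mul h2 using 1
    simp
  have hpdg : ∀ i x, fderiv ℝ (fun x => |w x| * w x * ψ x ^ 3) x (EuclideanSpace.single i 1)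
      = 2 * |w x| * pd w i x * ψ x ^ 3 + |w x| * w x * (3 * ψ x ^ 2 * pd ψ i x) := by
    intro i x
    rw [(hder x).fderiv]
    simp [pd]
    ring
  have hibp : ∀ i, ∫ x, |w x| * w x * ψ x ^ 3 * pd (f i) i x
      = -∫ x, (2 * |w x| * pd w i x * ψ x ^ 3
      + |w x| * w x * (3 * ψ x ^ 2 * pd ψ i x)) * f i x := by
    intro i
    have hfc := (hf i).continuous
    have c1 := hpd (hf i) i
    have c2 := hpd hw i
    have c3 := hpd hψ i
    have := integral_mul_fderiv_eq_neg_fderiv_mul_of_integrable (μ := (volume : Measure E3))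
      (f := fun x => |w x| * w x * ψ x ^ 3) (g := f i) (v := EuclideanSpace.single i 1)
      (by
        simp only [hpdg]
        exact hcs _ (by fun_prop) (by intro x hx; simp [hx]))
      (hcs _ (by unfold pd at c1; fun_prop) (by intro x hx; simp [hx]))
      (hcs _ (by fun_prop) (by intro x hx; simp [hx]))
      (fun x _ => (hder x).differentiableAt)
      (fun x _ => (hf i).differentiable (by simp) x)
    simp only [hpdg] at this
    exact this
  rw [← Finset.sum_congr rfl fun i _ => hibp i, ← integral_finsetSum]
  · refine integral_congr_ae (.of_forall fun x => ?_)
    simp only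
    rw [← Finset.mul_sum, ← hdiv]
    have := abs_mul_abs_self (w x)
    linear_combination |w x| * ψ x ^ 3 * this
  · intro i _
    have c1 := hpd (hf i) i
    exact hcs _ (by fun_prop) (by intro x hx; simp [hx])

theorem norm_pi_cube_le_sum (v : Fin 3 → ℝ) : ‖v‖ ^ 3 ≤ ∑ j, |v j| ^ 3 := by
  obtain ⟨j, hj⟩ : ∃ j, ‖v‖ = ‖v j‖ := by
    obtain ⟨j, -, hj⟩ := Finset.exists_mem_eq_sup Finset.univ Finset.univ_nonempty
      (fun j => ‖v j‖₊)
    exact ⟨j, by rw [Pi.norm_def, hj]; rfl⟩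
  rw [hj, Real.norm_eq_abs]
  exact Finset.single_le_sum (f := fun j => |v j| ^ 3) (fun _ _ => by positivity)
    (Finset.mem_univ j)

theorem abs_pd_le_norm_fderiv {f : E3 → ℝ} (i : Fin 3) (x : E3) : |pd f i x| ≤ ‖fderiv ℝ f x‖ := by
  have := (fderiv ℝ f x).le_opNorm (EuclideanSpace.single i 1)
  simpa [pd] using this

theorem norm_fderiv_component_le {u : E3 → Fin 3 → ℝ} {x : E3} (hu : DifferentiableAt ℝ u x)
    (j : Fin 3) : ‖fderiv ℝ (fun y => u y j) x‖ ≤ ‖fderiv ℝ u x‖ := by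
  refine ContinuousLinearMap.opNorm_le_bound _ (norm_nonneg _) fun v => ?_
  rw [fderiv_apply hu]
  exact (norm_le_pi_norm (fderiv ℝ u x v) j).trans ((fderiv ℝ u x).le_opNorm v)

/-- The estimate obtained by testing `u = ∇·v` against `|u_j| u_j ψ³` for each component. -/
theorem integral_norm_cube_mul_cutoff_le {u : E3 → Fin 3 → ℝ} {v : E3 → Fin 3 → Fin 3 → ℝ}
    {ψ : E3 → ℝ} {R K : ℝ} (hu : ContDiff ℝ 1 u) (hv : ContDiff ℝ 1 v) (hψ : ContDiff ℝ 1 ψ)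
    (hdiv : ∀ x j, u x j = matDiv v x j) (hψ0 : ∀ x, 0 ≤ ψ x) (hψ1 : ∀ x, ψ x ≤ 1)
    (hsupp : tsupport ψ ⊆ Metric.ball (0 : E3) R) (hK : ∀ x, ‖fderiv ℝ ψ x‖ ≤ K) :
    ∫ x in Metric.ball (0 : E3) R, ‖u x‖ ^ 3 * ψ x ^ 3
      ≤ 18 * (∫ x in Metric.ball (0 : E3) R, ‖v x‖ * (‖u x‖ * ψ x) * ‖fderiv ℝ u x‖)
        + 27 * K * ∫ x in Metric.ball (0 : E3) R, ‖v x‖ * (‖u x‖ * ψ x) ^ 2 := by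
  have hcs : HasCompactSupport ψ := HasCompactSupport.of_support_subset_isCompact
    (isCompact_closedBall (0 : E3) R)
    ((subset_tsupport ψ).trans (hsupp.trans Metric.ball_subset_closedBall))
  have hz : ∀ x, x ∉ Metric.ball (0 : E3) R → ψ x = 0 := fun x hx =>
    image_eq_zero_of_notMem_tsupport fun h => hx (hsupp h)
  have huj : ∀ j, ContDiff ℝ 1 (fun x => u x j) := fun j => contDiff_pi.1 hu j
  have hvij : ∀ i j, ContDiff ℝ 1 (fun x => v x i j) := fun i j =>
    contDiff_pi.1 (contDiff_pi.1 hv i) j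
  have huc := hu.continuous
  have hvc := hv.continuous
  have hψc := hψ.continuous
  have hDu := hu.continuous_fderiv (by simp)
  have hpd : ∀ {g : E3 → ℝ}, ContDiff ℝ 1 g → ∀ i, Continuous (pd g i) := fun hg i =>
    (hg.continuous_fderiv (by simp)).clm_apply continuous_const
  have hint1 : IntegrableOn (fun x => ‖v x‖ * (‖u x‖ * ψ x) * ‖fderiv ℝ u x‖)
    (Metric.ball (0 : E3) R) := Continuous.integrableOn_metric_ball (by fun_prop) R
  have hint2 : IntegrableOn (fun x => ‖v x‖ * (‖u x‖ * ψ x) ^ 2)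
    (Metric.ball (0 : E3) R) := Continuous.integrableOn_metric_ball (by fun_prop) R
  have hterm : ∀ i j, -∫ x, (2 * |u x j| * pd (fun y => u y j) i x * ψ x ^ 3
      + |u x j| * u x j * (3 * ψ x ^ 2 * pd ψ i x)) * v x i j
      ≤ 2 * (∫ x in Metric.ball (0 : E3) R, ‖v x‖ * (‖u x‖ * ψ x) * ‖fderiv ℝ u x‖)
        + 3 * K * ∫ x in Metric.ball (0 : E3) R, ‖v x‖ * (‖u x‖ * ψ x) ^ 2 := by
    intro i j
    have c1 := hpd (huj j) i
    have c2 := hpd hψ i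
    have c3 := (hvij i j).continuous
    have c4 := (huj j).continuous
    rw [← setIntegral_eq_integral_of_forall_compl_eq_zero (s := Metric.ball (0 : E3) R)
      (by intro x hx; simp [hz x hx]), ← integral_neg, ← integral_const_mul, ← integral_const_mul,
      ← integral_add (hint1.const_mul _) (hint2.const_mul _)]
    refine integral_mono (Continuous.integrableOn_metric_ball (by fun_prop) R)
      ((hint1.const_mul _).add (hint2.const_mul _)) fun x => ?_
    refine (neg_le_abs _).trans ?_
    have b1 : |u x j| ≤ ‖u x‖ := norm_le_pi_norm (u x) j
    have b2 : |pd (fun y => u y j) i x| ≤ ‖fderiv ℝ u x‖ :=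
      (abs_pd_le_norm_fderiv i x).trans (norm_fderiv_component_le (hu.differentiable (by simp) x) j)
    have b3 : |v x i j| ≤ ‖v x‖ := (norm_le_pi_norm (v x i) j).trans (norm_le_pi_norm (v x) i)
    have b4 : |pd ψ i x| ≤ K := (abs_pd_le_norm_fderiv i x).trans (hK x)
    have hK0 : 0 ≤ K := (norm_nonneg _).trans (hK x)
    have hp := hψ0 x
    have b5 : ψ x ^ 3 ≤ ψ x := pow_le_of_le_one hp (hψ1 x) (by norm_num)
    rw [abs_mul]
    calc _ ≤ (2 * |u x j| * |pd (fun y => u y j) i x| * ψ x ^ 3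
          + |u x j| * |u x j| * (3 * ψ x ^ 2 * |pd ψ i x|)) * |v x i j| := by
          gcongr
          refine (abs_add_le _ _).trans (le_of_eq ?_)
          simp [abs_mul, abs_of_nonneg hp]
      _ ≤ (2 * ‖u x‖ * ‖fderiv ℝ u x‖ * ψ x + ‖u x‖ * ‖u x‖ * (3 * ψ x ^ 2 * K)) * ‖v x‖ := by
          gcongr
      _ = _ := by ring
  have hcomp : ∀ j, ∫ x in Metric.ball (0 : E3) R, |u x j| ^ 3 * ψ x ^ 3
      ≤ 6 * (∫ x in Metric.ball (0 : E3) R, ‖v x‖ * (‖u x‖ * ψ x) * ‖fderiv ℝ u x‖)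
        + 9 * K * ∫ x in Metric.ball (0 : E3) R, ‖v x‖ * (‖u x‖ * ψ x) ^ 2 := by
    intro j
    rw [setIntegral_eq_integral_of_forall_compl_eq_zero (by intro x hx; simp [hz x hx]),
      integral_abs_cube_mul_cutoff_eq (fun i => hvij i j) (huj j) hψ hcs (fun x => hdiv x j)]
    refine (Finset.sum_le_sum fun i _ => hterm i j).trans (le_of_eq ?_)
    simp only [Finset.sum_const, Finset.card_univ, Fintype.card_fin, nsmul_eq_mul]
    push_cast
    ring
  have hji : ∀ j, IntegrableOn (fun x => |u x j| ^ 3 * ψ x ^ 3) (Metric.ball (0 : E3) R) := by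
    intro j
    have c4 := (huj j).continuous
    exact Continuous.integrableOn_metric_ball (by fun_prop) R
  calc _ ≤ ∫ x in Metric.ball (0 : E3) R, ∑ j, |u x j| ^ 3 * ψ x ^ 3 := by
        refine integral_mono (Continuous.integrableOn_metric_ball (by fun_prop) R)
          (integrable_finsetSum _ fun j _ => hji j) fun x => ?_
        simp only
        rw [← Finset.sum_mul]
        have := hψ0 x
        gcongr
        exact norm_pi_cube_le_sum (u x)
    _ = ∑ j, ∫ x in Metric.ball (0 : E3) R, |u x j| ^ 3 * ψ x ^ 3 :=
        integral_finsetSum _ fun j _ => hji j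
    _ ≤ _ := Finset.sum_le_sum fun j _ => hcomp j
    _ = _ := by
        simp only [Finset.sum_const, Finset.card_univ, Fintype.card_fin, nsmul_eq_mul]
        push_cast
        ring

theorem volume_real_ball_E3 {R : ℝ} (hR : 0 ≤ R) :
    volume.real (Metric.ball (0 : E3) R) = R ^ 3 * (Real.pi * 4 / 3) := by
  rw [measureReal_def, EuclideanSpace.volume_ball_fin_three, ENNReal.toReal_mul,
    ENNReal.toReal_pow, ENNReal.toReal_ofReal hR, ENNReal.toReal_ofReal (by positivity)]

/-- For `u = ∇·Φ` and a cutoff `ψ` with `0 ≤ ψ ≤ 1` supported in `B(R)` and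
`|∇ψ| ≤ c (R-ρ)⁻¹` (with `1 ≤ ρ < R ≤ 2ρ`), one has
`∫ |u|³ψ³ ≤ C (∫|Φ-Φ_{B(R)}|⁶)^(1/4) (∫|∇u|²)^(3/4)
  + C R^(3/2) (R-ρ)⁻³ (∫|Φ-Φ_{B(R)}|⁶)^(1/2)`. -/
theorem stmt_6 (c : ℝ) (hc : 0 < c) :
    ∃ C : ℝ, 0 < C ∧
      ∀ (R ρ : ℝ) (u : E3 → Fin 3 → ℝ) (Φ : E3 → Fin 3 → Fin 3 → ℝ) (ψ : E3 → ℝ),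
        1 ≤ ρ → ρ < R → R ≤ 2 * ρ →
        ContDiff ℝ (⊤ : ℕ∞) u → ContDiff ℝ (⊤ : ℕ∞) Φ →
        (∀ x j, u x j = matDiv Φ x j) →
        ContDiff ℝ (⊤ : ℕ∞) ψ → (∀ x, 0 ≤ ψ x) → (∀ x, ψ x ≤ 1) →
        tsupport ψ ⊆ Metric.ball (0 : E3) R →
        (∀ x, ‖fderiv ℝ ψ x‖ ≤ c * (R - ρ)⁻¹) →
        (∫ x in Metric.ball (0 : E3) R, ‖u x‖ ^ 3 * ψ x ^ 3)
          ≤ C * (∫ x in Metric.ball (0 : E3) R,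
                ‖(fun (i j : Fin 3) => Φ x i j - ⨍ y in Metric.ball (0 : E3) R, Φ y i j)‖ ^ 6)
                ^ ((1 : ℝ) / 4)
              * (∫ x in Metric.ball (0 : E3) R, ‖fderiv ℝ u x‖ ^ 2) ^ ((3 : ℝ) / 4)
            + C * R ^ ((3 : ℝ) / 2) * (R - ρ)⁻¹ ^ 3
              * (∫ x in Metric.ball (0 : E3) R,
                ‖(fun (i j : Fin 3) => Φ x i j - ⨍ y in Metric.ball (0 : E3) R, Φ y i j)‖ ^ 6)
                ^ ((1 : ℝ) / 2) := by
  refine ⟨216 + (54 * c) ^ 3 * (Real.pi * 4 / 3) ^ ((1 : ℝ) / 2), by positivity, ?_⟩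
  intro R ρ u Φ ψ hρ hρR _ hu hΦ hdiv hψ hψ0 hψ1 hsupp hgrad
  have hR : 0 < R := by linarith
  have hK : 0 ≤ (R - ρ)⁻¹ := inv_nonneg.2 (by linarith)
  set m : Fin 3 → Fin 3 → ℝ := fun i j => ⨍ y in Metric.ball (0 : E3) R, Φ y i j
  set v : E3 → Fin 3 → Fin 3 → ℝ := fun x i j => Φ x i j - m i j with hv_def
  change _ ≤ _ * (∫ x in Metric.ball (0 : E3) R, ‖v x‖ ^ 6) ^ ((1 : ℝ) / 4) * _
    + _ * (∫ x in Metric.ball (0 : E3) R, ‖v x‖ ^ 6) ^ ((1 : ℝ) / 2)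
  have hu1 : ContDiff ℝ 1 u := hu.of_le (by simp)
  have hψ1' : ContDiff ℝ 1 ψ := hψ.of_le (by simp)
  have hv : ContDiff ℝ 1 v := (hΦ.of_le (by simp)).sub (contDiff_const (c := m))
  have hdivv : ∀ x j, u x j = matDiv v x j := by
    intro x j
    rw [hdiv]
    simp [matDiv, pd, hv_def, fderiv_sub_const]
  have hmain := integral_norm_cube_mul_cutoff_le hu1 hv hψ1' hdivv hψ0 hψ1 hsupp hgrad
  have huc := hu1.continuous
  have hvc := hv.continuous
  have hψc := hψ1'.continuous
  have hDu := hu1.continuous_fderiv (by simp)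
  have iA : IntegrableOn (fun x => ‖v x‖ ^ 6) (Metric.ball (0 : E3) R) :=
    Continuous.integrableOn_metric_ball (by fun_prop) R
  have iX : IntegrableOn (fun x => ‖u x‖ ^ 3 * ψ x ^ 3) (Metric.ball (0 : E3) R) :=
    Continuous.integrableOn_metric_ball (by fun_prop) R
  have iD : IntegrableOn (fun x => ‖fderiv ℝ u x‖ ^ 2) (Metric.ball (0 : E3) R) :=
    Continuous.integrableOn_metric_ball (by fun_prop) R
  have i1 : IntegrableOn (fun _ => (1 : ℝ)) (Metric.ball (0 : E3) R) :=
    Continuous.integrableOn_metric_ball (by fun_prop) R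
  have nA : ∀ x, 0 ≤ ‖v x‖ ^ 6 := fun x => by positivity
  have nX : ∀ x, 0 ≤ ‖u x‖ ^ 3 * ψ x ^ 3 := fun x => by have := hψ0 x; positivity
  have nD : ∀ x, 0 ≤ ‖fderiv ℝ u x‖ ^ 2 := fun x => by positivity
  have rA : ∀ x, (‖v x‖ ^ 6) ^ ((1 : ℝ) / 6) = ‖v x‖ := fun x => by
    rw [← Real.rpow_natCast, ← Real.rpow_mul (norm_nonneg _)]; norm_num
  have rX : ∀ x, (‖u x‖ ^ 3 * ψ x ^ 3) ^ ((1 : ℝ) / 3) = ‖u x‖ * ψ x := fun x => by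
    rw [← mul_pow, ← Real.rpow_natCast, ← Real.rpow_mul (mul_nonneg (norm_nonneg _) (hψ0 x))]
    norm_num
  have rX2 : ∀ x, (‖u x‖ ^ 3 * ψ x ^ 3) ^ ((2 : ℝ) / 3) = (‖u x‖ * ψ x) ^ 2 := fun x => by
    rw [← mul_pow, ← Real.rpow_natCast, ← Real.rpow_mul (mul_nonneg (norm_nonneg _) (hψ0 x)),
      ← Real.rpow_natCast]
    norm_num
  have rD : ∀ x, (‖fderiv ℝ u x‖ ^ 2) ^ ((1 : ℝ) / 2) = ‖fderiv ℝ u x‖ := fun x => by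
    rw [← Real.rpow_natCast, ← Real.rpow_mul (norm_nonneg _)]; norm_num
  have h1 := integral_rpow_mul_rpow_mul_rpow_le iA iX iD nA nX nD
    (a := 1 / 6) (b := 1 / 3) (c := 1 / 2)
    (by norm_num) (by norm_num) (by norm_num) (by norm_num)
  have h2 := integral_rpow_mul_rpow_mul_rpow_le iA iX i1 nA nX (fun _ => zero_le_one)
    (a := 1 / 6) (b := 2 / 3) (c := 1 / 6)
    (by norm_num) (by norm_num) (by norm_num) (by norm_num)
  simp only [rA, rX, rX2, rD, Real.one_rpow, mul_one] at h1 h2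
  rw [setIntegral_const, smul_eq_mul, mul_one, volume_real_ball_E3 hR.le] at h2
  have A0 : 0 ≤ ∫ x in Metric.ball (0 : E3) R, ‖v x‖ ^ 6 := integral_nonneg nA
  have X0 : 0 ≤ ∫ x in Metric.ball (0 : E3) R, ‖u x‖ ^ 3 * ψ x ^ 3 := integral_nonneg nX
  have D0 : 0 ≤ ∫ x in Metric.ball (0 : E3) R, ‖fderiv ℝ u x‖ ^ 2 := integral_nonneg nD
  generalize (∫ x in Metric.ball (0 : E3) R, ‖v x‖ ^ 6) = A at *
  generalize (∫ x in Metric.ball (0 : E3) R, ‖u x‖ ^ 3 * ψ x ^ 3) = X at *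
  generalize (∫ x in Metric.ball (0 : E3) R, ‖fderiv ℝ u x‖ ^ 2) = D at *
  generalize (R - ρ)⁻¹ = k at *
  generalize hL : Real.pi * 4 / 3 = L at *
  have L0 : 0 ≤ L := hL ▸ by positivity
  have x3 : (X ^ ((1 : ℝ) / 3)) ^ 3 = X := by
    rw [← Real.rpow_natCast, ← Real.rpow_mul X0]; norm_num
  have x2 : (X ^ ((1 : ℝ) / 3)) ^ 2 = X ^ ((2 : ℝ) / 3) := by
    rw [← Real.rpow_natCast, ← Real.rpow_mul X0]; norm_num
  have hXle := cube_le_of_cube_le_add (x := X ^ ((1 : ℝ) / 3))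
    (p := 18 * (A ^ ((1 : ℝ) / 6) * D ^ ((1 : ℝ) / 2)))
    (q := 27 * (c * k) * (A ^ ((1 : ℝ) / 6) * (R ^ 3 * L) ^ ((1 : ℝ) / 6)))
    (by positivity) (by positivity) (by positivity) (by
      rw [x3, x2]
      have h1' := mul_le_mul_of_nonneg_left h1 (by norm_num : (0 : ℝ) ≤ 18)
      have h2' := mul_le_mul_of_nonneg_left h2 (by positivity : (0 : ℝ) ≤ 27 * (c * k))
      linarith)
  rw [x3] at hXle
  have e1 : (2 * (18 * (A ^ ((1 : ℝ) / 6) * D ^ ((1 : ℝ) / 2)))) ^ ((3 : ℝ) / 2)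
      = 216 * A ^ ((1 : ℝ) / 4) * D ^ ((3 : ℝ) / 4) := by
    rw [show 2 * (18 * (A ^ ((1 : ℝ) / 6) * D ^ ((1 : ℝ) / 2)))
        = (6 : ℝ) ^ (2 : ℝ) * (A ^ ((1 : ℝ) / 6) * D ^ ((1 : ℝ) / 2)) by norm_num; ring,
      Real.mul_rpow (by positivity) (by positivity), Real.mul_rpow (by positivity) (by positivity),
      ← Real.rpow_mul (by norm_num), ← Real.rpow_mul A0, ← Real.rpow_mul D0]
    norm_num
    ring
  have e2 : (2 * (27 * (c * k) * (A ^ ((1 : ℝ) / 6) * (R ^ 3 * L) ^ ((1 : ℝ) / 6)))) ^ 3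
      = (54 * c) ^ 3 * L ^ ((1 : ℝ) / 2) * R ^ ((3 : ℝ) / 2) * k ^ 3 * A ^ ((1 : ℝ) / 2) := by
    have a3 : (A ^ ((1 : ℝ) / 6)) ^ 3 = A ^ ((1 : ℝ) / 2) := by
      rw [← Real.rpow_natCast, ← Real.rpow_mul A0]; norm_num
    have r3 : ((R ^ 3 * L) ^ ((1 : ℝ) / 6)) ^ 3 = R ^ ((3 : ℝ) / 2) * L ^ ((1 : ℝ) / 2) := by
      rw [← Real.rpow_natCast, ← Real.rpow_mul (by positivity),
        Real.mul_rpow (by positivity) L0, ← Real.rpow_natCast R, ← Real.rpow_mul hR.le]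
      norm_num
    rw [mul_pow, mul_pow, mul_pow (A ^ _), a3, r3]
    ring
  rw [e1, e2] at hXle
  refine hXle.trans ?_
  have hc3 : 0 ≤ (54 * c) ^ 3 * L ^ ((1 : ℝ) / 2) := by positivity
  gcongr
  · linarith
  · linarith
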